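/- Let n ≥ 1 and 0 < p < ∞, and set τ = min(p, 2). There is a constant C > 0 depending only on n and p such that for every α ≥ 1 and every locally square integrable function g on (0,∞)×ℝⁿ, ‖g‖_{T^{p,2}_α} ≤ C α^{n/τ} ‖g‖_{T^{p,2}_1}. -/

import Mathlib

open MeasureTheory Metric Set Filter ENNReal

noncomputable section

/-- `ℝⁿ` as a Euclidean space. -/
abbrev En (n : ℕ) : Type := EuclideanSpace ℝ (Fin n)

/-- `g` is (measurable and) locally square integrable on `(0,∞) × ℝⁿ`. -/
def LocSqInt (n : ℕ) (g : ℝ → En n → ℝ) : Prop :=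
  Measurable (Function.uncurry g) ∧
  LocallyIntegrableOn (fun q : ℝ × En n => (g q.1 q.2) ^ 2)
    (Set.Ioi (0 : ℝ) ×ˢ (Set.univ : Set (En n)))

/-- The conical square function `A^{(α)} g (x)` of aperture `α`, with values in `[0,∞]`. -/
def conicalSq (n : ℕ) (α : ℝ) (g : ℝ → En n → ℝ) (x : En n) : ℝ≥0∞ :=
  (∫⁻ t in Set.Ioi (0 : ℝ), ∫⁻ y,
      (ball x (α * t)).indicator (fun y => ENNReal.ofReal (|g t y| ^ 2 / t ^ (n + 1))) y) ^
    (1 / 2 : ℝ)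

/-- The tent space quasi-norm `‖g‖_{T^{p,2}_α} = ‖A^{(α)} g‖_{L^p(ℝⁿ)}`, with values in `[0,∞]`. -/
def tentNorm (n : ℕ) (p α : ℝ) (g : ℝ → En n → ℝ) : ℝ≥0∞ :=
  (∫⁻ x, conicalSq n α g x ^ p) ^ (1 / p)

/-- The vertical square function `V g (x)`. -/
def vertSq (n : ℕ) (g : ℝ → En n → ℝ) (x : En n) : ℝ≥0∞ :=
  (∫⁻ t in Set.Ioi (0 : ℝ), ENNReal.ofReal (|g t x| ^ 2 / t)) ^ (1 / 2 : ℝ)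

/-- `‖V g‖_{L^p(ℝⁿ)}`, with values in `[0,∞]`. -/
def vertNorm (n : ℕ) (p : ℝ) (g : ℝ → En n → ℝ) : ℝ≥0∞ :=
  (∫⁻ x, vertSq n g x ^ p) ^ (1 / p)

/-- The tent `T_α B` of aperture `α` above the ball `B = B(x,r)`. -/
def tent (n : ℕ) (α : ℝ) (x : En n) (r : ℝ) : Set (ℝ × En n) :=
  {q | 0 < q.1 ∧ q.1 < r / α ∧ q.2 ∈ ball x (r - α * q.1)}

/-- `∫_{T_α B} |g(t,y)|² dy dt / t`. -/
def tentIntegral (n : ℕ) (α : ℝ) (g : ℝ → En n → ℝ) (x : En n) (r : ℝ) : ℝ≥0∞ :=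
  ∫⁻ q in tent n α x r, ENNReal.ofReal (|g q.1 q.2| ^ 2 / q.1)

/-- A `T^{p,2}_α`-atom associated with the ball `B(x,r)`: it is supported in the tent
`T_α B(x,r)` and satisfies `∫_{T_α B} |a|² dy dt/t ≤ α^{-n} |B|^{-(2/p - 1)}`. -/
def IsTentAtom (n : ℕ) (p α : ℝ) (a : ℝ → En n → ℝ) (x : En n) (r : ℝ) : Prop :=
  (∀ t y, (t, y) ∉ tent n α x r → a t y = 0) ∧
  tentIntegral n α a x r ≤
    ENNReal.ofReal (α ^ (-(n : ℝ))) * volume (ball x r) ^ (-(2 / p - 1))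

/-- The grand square function `G_λ g (x)` with exponent `nλ`. -/
def grandSq (n : ℕ) (l : ℝ) (g : ℝ → En n → ℝ) (x : En n) : ℝ≥0∞ :=
  (∫⁻ t in Set.Ioi (0 : ℝ), ∫⁻ y,
      ENNReal.ofReal ((t / (dist x y + t)) ^ ((n : ℝ) * l) * |g t y| ^ 2 / t ^ (n + 1))) ^
    (1 / 2 : ℝ)

theorem lintegral_mul_setLIntegral_swap {β γ : Type*} [MeasurableSpace β] [MeasurableSpace γ]
    (ν : Measure β) (μ : Measure γ) [SFinite ν] [SFinite μ] {c : β → ℝ≥0∞} {φ : γ → ℝ≥0∞}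
    (hc : Measurable c) (hφ : Measurable φ) {S : Set (β × γ)} (hS : MeasurableSet S) :
    ∫⁻ t, c t * ∫⁻ x in {x | (t, x) ∈ S}, φ x ∂μ ∂ν =
      ∫⁻ x, φ x * ∫⁻ t in {t | (t, x) ∈ S}, c t ∂ν ∂μ := by
  have hm : Measurable (Function.uncurry fun t x => S.indicator (fun q => c q.1 * φ q.2) (t, x)) :=
    ((hc.comp measurable_fst).mul (hφ.comp measurable_snd)).indicator hS
  calc ∫⁻ t, c t * ∫⁻ x in {x | (t, x) ∈ S}, φ x ∂μ ∂ν
      = ∫⁻ t, ∫⁻ x, S.indicator (fun q => c q.1 * φ q.2) (t, x) ∂μ ∂ν := by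
        refine lintegral_congr fun t => ?_
        have hSt : MeasurableSet {x | (t, x) ∈ S} := measurable_prodMk_left hS
        rw [← lintegral_indicator hSt, ← lintegral_const_mul _ (hφ.indicator hSt)]
        refine lintegral_congr fun x => ?_
        by_cases h : (t, x) ∈ S <;> simp [h, indicator]
    _ = ∫⁻ x, ∫⁻ t, S.indicator (fun q => c q.1 * φ q.2) (t, x) ∂ν ∂μ :=
        lintegral_lintegral_swap hm.aemeasurable
    _ = _ := by
        refine lintegral_congr fun x => ?_
        have hSx : MeasurableSet {t | (t, x) ∈ S} := measurable_prodMk_right hS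
        rw [← lintegral_indicator hSx, ← lintegral_const_mul _ (hc.indicator hSx)]
        refine lintegral_congr fun t => ?_
        by_cases h : (t, x) ∈ S <;> simp [h, indicator, mul_comm]

theorem measurable_ofReal_rpow (s : ℝ) : Measurable fun t : ℝ => ENNReal.ofReal (t ^ s) := by
  fun_prop

theorem lintegral_Ioo_zero_rpow {p : ℝ} (hp : 0 < p) {a : ℝ} (ha : 0 ≤ a) :
    ∫⁻ t in Ioo 0 a, ENNReal.ofReal (t ^ (p - 1)) = ENNReal.ofReal (a ^ p / p) := by
  have hI : IntervalIntegrable (fun x : ℝ => x ^ (p - 1)) volume 0 a :=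
    intervalIntegral.intervalIntegrable_rpow' (by linarith)
  have h := integral_rpow (a := 0) (b := a) (r := p - 1) (Or.inl (by linarith))
  rw [intervalIntegral.integral_of_le ha] at h
  rw [setLIntegral_congr Ioo_ae_eq_Ioc, ← ofReal_integral_eq_lintegral_ofReal, h]
  · simp [Real.zero_rpow hp.ne']
  · exact (intervalIntegrable_iff_integrableOn_Ioc_of_le ha).1 hI
  · refine (ae_restrict_iff' measurableSet_Ioc).2 (ae_of_all _ fun t ht => ?_)
    exact Real.rpow_nonneg ht.1.le _

theorem lintegral_rpow_sub_one_of_lt {p : ℝ} (hp : 0 < p) (a : ℝ≥0∞) :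
    ∫⁻ t in {t | ENNReal.ofReal t < a}, ENNReal.ofReal (t ^ (p - 1))
      ∂(volume.restrict (Ioi (0 : ℝ))) = a ^ p * ENNReal.ofReal p⁻¹ := by
  have hmeas : MeasurableSet {t : ℝ | ENNReal.ofReal t < a} :=
    measurableSet_lt (by fun_prop) (by fun_prop)
  rw [Measure.restrict_restrict hmeas]
  rcases eq_or_ne a ⊤ with rfl | ha
  · rw [ENNReal.top_rpow_of_pos hp, ENNReal.top_mul (by simpa using hp)]
    have hset : {t : ℝ | ENNReal.ofReal t < ⊤} ∩ Ioi 0 = Ioi 0 := by ext; simp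
    rw [hset, eq_top_iff]
    have hlim : Tendsto (fun b : ℝ => ENNReal.ofReal (b ^ p / p)) atTop (nhds ⊤) :=
      ENNReal.tendsto_ofReal_atTop.comp ((tendsto_rpow_atTop hp).atTop_div_const hp)
    refine le_of_tendsto hlim ((eventually_ge_atTop 0).mono fun b hb => ?_)
    rw [← lintegral_Ioo_zero_rpow hp hb]
    exact lintegral_mono_set Ioo_subset_Ioi_self
  · have hset : {t : ℝ | ENNReal.ofReal t < a} ∩ Ioi 0 = Ioo 0 a.toReal := by
      ext t
      rw [mem_inter_iff, mem_ofPred_eq, mem_Ioi, mem_Ioo, and_comm]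
      exact and_congr_right fun ht => ENNReal.ofReal_lt_iff_lt_toReal ht.le ha
    rw [hset, lintegral_Ioo_zero_rpow hp ENNReal.toReal_nonneg, div_eq_mul_inv,
      ENNReal.ofReal_mul (by positivity), ← ENNReal.ofReal_rpow_of_nonneg
        ENNReal.toReal_nonneg hp.le, ENNReal.ofReal_toReal ha]

theorem mul_lintegral_rpow_sub_three_of_le {p : ℝ} (hp2 : p < 2) (a : ℝ≥0∞) :
    a ^ (2 : ℝ) * ∫⁻ t in {t | a ≤ ENNReal.ofReal t}, ENNReal.ofReal (t ^ (p - 3))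
      ∂(volume.restrict (Ioi (0 : ℝ))) ≤ a ^ p * ENNReal.ofReal (2 - p)⁻¹ := by
  have hmeas : MeasurableSet {t : ℝ | a ≤ ENNReal.ofReal t} :=
    measurableSet_le (by fun_prop) (by fun_prop)
  rw [Measure.restrict_restrict hmeas]
  rcases eq_or_ne a ⊤ with rfl | ha
  · simp
  rcases eq_or_ne a 0 with rfl | ha0
  · simp
  have hpos : 0 < a.toReal := ENNReal.toReal_pos ha0 ha
  have hset : {t : ℝ | a ≤ ENNReal.ofReal t} ∩ Ioi 0 = Ici a.toReal := by
    ext t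
    simp only [mem_inter_iff, mem_ofPred_eq, mem_Ioi, mem_Ici]
    constructor
    · rintro ⟨h, ht⟩
      exact (ENNReal.le_ofReal_iff_toReal_le ha ht.le).1 h
    · intro h
      exact ⟨(ENNReal.le_ofReal_iff_toReal_le ha (hpos.le.trans h)).2 h, hpos.trans_le h⟩
  rw [hset, setLIntegral_congr Ioi_ae_eq_Ici.symm, ← ofReal_integral_eq_lintegral_ofReal
    (integrableOn_Ioi_rpow_of_lt (by linarith) hpos), integral_Ioi_rpow_of_lt (by linarith) hpos]
  · have hval : -a.toReal ^ (p - 3 + 1) / (p - 3 + 1) = a.toReal ^ (p - 2) * (2 - p)⁻¹ := by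
      rw [show p - 3 + 1 = p - 2 by ring, ← neg_sub 2 p]
      field_simp
    rw [hval, ENNReal.ofReal_mul (by positivity), ← ENNReal.ofReal_rpow_of_pos hpos,
      ENNReal.ofReal_toReal ha, ← mul_assoc, ← ENNReal.rpow_add _ _ ha0 ha]
    simp
  · refine (ae_restrict_iff' measurableSet_Ioi).2 (ae_of_all _ fun t ht => ?_)
    exact Real.rpow_nonneg (hpos.trans ht).le _

theorem measurableSet_ofReal_lt {γ : Type*} [MeasurableSpace γ] {f : γ → ℝ≥0∞}
    (hf : Measurable f) : MeasurableSet {q : ℝ × γ | ENNReal.ofReal q.1 < f q.2} :=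
  measurableSet_lt (by fun_prop) (by fun_prop)

theorem lintegral_rpow_mul_eq_layercake {γ : Type*} [MeasurableSpace γ] (μ : Measure γ) [SFinite μ]
    {p : ℝ} (hp : 0 < p) {f φ : γ → ℝ≥0∞} (hf : Measurable f) (hφ : Measurable φ) :
    ∫⁻ t in Ioi (0 : ℝ), ENNReal.ofReal (t ^ (p - 1)) *
      ∫⁻ x in {x | ENNReal.ofReal t < f x}, φ x ∂μ =
    ENNReal.ofReal p⁻¹ * ∫⁻ x, f x ^ p * φ x ∂μ := by
  have h := lintegral_mul_setLIntegral_swap (volume.restrict (Ioi (0 : ℝ))) μ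
    (measurable_ofReal_rpow (p - 1)) hφ (measurableSet_ofReal_lt hf)
  simp only [mem_ofPred_eq, lintegral_rpow_sub_one_of_lt hp] at h
  rw [h, ← lintegral_const_mul _ (by fun_prop)]
  exact lintegral_congr fun x => by ring

theorem lintegral_rpow_eq_layercake {γ : Type*} [MeasurableSpace γ] (μ : Measure γ) [SFinite μ]
    {p : ℝ} (hp : 0 < p) {f : γ → ℝ≥0∞} (hf : Measurable f) :
    ∫⁻ t in Ioi (0 : ℝ), ENNReal.ofReal (t ^ (p - 1)) * μ {x | ENNReal.ofReal t < f x} =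
    ENNReal.ofReal p⁻¹ * ∫⁻ x, f x ^ p ∂μ := by
  simpa using lintegral_rpow_mul_eq_layercake μ hp hf (φ := fun _ => 1) measurable_const

/-- The uncentered Hardy–Littlewood maximal function. -/
def maxFn {n : ℕ} (h : En n → ℝ≥0∞) (x : En n) : ℝ≥0∞ :=
  ⨆ (y : En n) (r : ℝ) (_ : x ∈ ball y r), (volume (ball y r))⁻¹ * ∫⁻ z in ball y r, h z

theorem lt_maxFn_iff {n : ℕ} {h : En n → ℝ≥0∞} {x : En n} {l : ℝ≥0∞} :
    l < maxFn h x ↔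
      ∃ y r, x ∈ ball y r ∧ l < (volume (ball y r))⁻¹ * ∫⁻ z in ball y r, h z := by
  simp only [maxFn, lt_iSup_iff, exists_prop]

theorem le_maxFn {n : ℕ} (h : En n → ℝ≥0∞) {x y : En n} {r : ℝ} (hx : x ∈ ball y r) :
    ∫⁻ z in ball y r, h z ≤ volume (ball y r) * maxFn h x := by
  have hr : 0 < r := pos_of_mem_ball hx
  have hle : (volume (ball y r))⁻¹ * ∫⁻ z in ball y r, h z ≤ maxFn h x :=
    le_iSup_of_le y <| le_iSup_of_le r <| le_iSup_of_le hx le_rfl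
  rw [mul_comm, ← div_eq_mul_inv] at hle
  rw [mul_comm]
  exact (ENNReal.div_le_iff (measure_ball_pos volume y hr).ne' measure_ball_lt_top.ne).1 hle

theorem isOpen_lt_maxFn {n : ℕ} (h : En n → ℝ≥0∞) (l : ℝ≥0∞) : IsOpen {x | l < maxFn h x} := by
  simp only [lt_maxFn_iff]
  refine isOpen_iff_mem_nhds.2 fun x ⟨y, r, hx, hl⟩ => ?_
  exact mem_of_superset (isOpen_ball.mem_nhds hx) fun z hz => ⟨y, r, hz, hl⟩

theorem measurable_maxFn {n : ℕ} (h : En n → ℝ≥0∞) : Measurable (maxFn h) :=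
  measurable_of_Ioi fun l => (isOpen_lt_maxFn h l).measurableSet

theorem volume_ball_mul {n : ℕ} {α : ℝ} (hα : 0 < α) (r : ℝ) (y : En n) :
    volume (ball y (α * r)) = ENNReal.ofReal (α ^ n) * volume (ball y r) := by
  rw [Measure.addHaar_ball_mul_of_pos _ _ hα, finrank_euclideanSpace_fin,
    Measure.addHaar_ball_center volume y]

theorem volume_closedBall_mul {n : ℕ} {α r : ℝ} (hα : 0 < α) (hr : 0 < r) (y : En n) :
    volume (closedBall y (α * r)) = ENNReal.ofReal (α ^ n) * volume (ball y r) := by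
  rw [Measure.addHaar_closedBall _ _ (by positivity), Measure.addHaar_ball_of_pos _ _ hr, ← mul_assoc,
    ← ENNReal.ofReal_mul (by positivity), mul_pow, finrank_euclideanSpace_fin]

/-- Weak type (1,1) bound for the maximal function. -/
theorem mul_volume_lt_maxFn_le {n : ℕ} (h : En n → ℝ≥0∞) (l : ℝ≥0∞) :
    l * volume {x | l < maxFn h x} ≤ ENNReal.ofReal (5 ^ n) * ∫⁻ x, h x := by
  rw [(isOpen_lt_maxFn h l).measure_eq_iSup_isCompact]
  simp only [ENNReal.mul_iSup]
  refine iSup_le fun K => iSup_le fun hK => iSup_le fun hKc => ?_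
  have hex : ∀ x ∈ K, ∃ y r, x ∈ ball y r ∧
      l < (volume (ball y r))⁻¹ * ∫⁻ z in ball y r, h z := fun x hx => lt_maxFn_iff.1 (hK hx)
  choose! y r hxy hl using hex
  obtain ⟨s, hsK, hs⟩ := hKc.elim_nhds_subcover (fun x => ball (y x) (r x))
    fun x hx => isOpen_ball.mem_nhds (hxy x hx)
  obtain ⟨R, hR⟩ := (s.image r).bddAbove
  obtain ⟨u, hus, hdisj, hcov⟩ := Vitali.exists_disjoint_subfamily_covering_enlargement_closedBall
    (s : Set (En n)) y r R
    (fun a ha => hR (by simpa using ⟨a, ha, rfl⟩)) 5 (by norm_num)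
  have hufin : u.Finite := s.finite_toSet.subset hus
  lift u to Finset (En n) using hufin
  have hrpos : ∀ b ∈ u, 0 < r b := fun b hb => pos_of_mem_ball (hxy b (hsK b (hus hb)))
  have hsub : K ⊆ ⋃ b ∈ u, closedBall (y b) (5 * r b) := by
    intro x hx
    obtain ⟨a, ha, hxa⟩ := mem_iUnion₂.1 (hs hx)
    obtain ⟨b, hb, hab⟩ := hcov a ha
    exact mem_iUnion₂.2 ⟨b, hb, hab (ball_subset_closedBall hxa)⟩
  calc l * volume K ≤ l * ∑ b ∈ u, volume (closedBall (y b) (5 * r b)) := by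
        gcongr
        exact (measure_mono hsub).trans (measure_biUnion_finset_le _ _)
    _ = ENNReal.ofReal (5 ^ n) * ∑ b ∈ u, l * volume (ball (y b) (r b)) := by
        rw [Finset.mul_sum, Finset.mul_sum]
        refine Finset.sum_congr rfl fun b hb => ?_
        rw [volume_closedBall_mul (by norm_num) (hrpos b hb)]
        ring
    _ ≤ ENNReal.ofReal (5 ^ n) * ∑ b ∈ u, ∫⁻ z in ball (y b) (r b), h z := by
        gcongr with b hb
        have hlb := (hl b (hsK b (hus hb))).le
        rw [mul_comm, ← div_eq_mul_inv] at hlb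
        exact (ENNReal.le_div_iff_mul_le (Or.inl (measure_ball_pos _ _ (hrpos b hb)).ne')
          (Or.inl measure_ball_lt_top.ne)).1 hlb
    _ = ENNReal.ofReal (5 ^ n) * ∫⁻ z in ⋃ b ∈ u, ball (y b) (r b), h z := by
        rw [lintegral_biUnion_finset _ fun b _ => measurableSet_ball]
        exact hdisj.mono fun b => ball_subset_closedBall
    _ ≤ _ := by exact mul_le_mul_right (setLIntegral_le_lintegral _ _) _

theorem maxFn_le_add {n : ℕ} {h : En n → ℝ≥0∞} (hh : Measurable h) (l : ℝ≥0∞) (x : En n) :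
    maxFn h x ≤ maxFn ({x | l < h x}.indicator h) x + l := by
  have hS : MeasurableSet {x | l < h x} := measurableSet_lt measurable_const hh
  refine iSup_le fun y => iSup_le fun r => iSup_le fun hx => ?_
  have hr : 0 < r := pos_of_mem_ball hx
  have h0 := (measure_ball_pos volume y hr).ne'
  have htop := (measure_ball_lt_top (μ := volume) (x := y) (r := r)).ne
  rw [mul_comm, ← div_eq_mul_inv]
  refine ENNReal.div_le_of_le_mul ?_
  calc ∫⁻ z in ball y r, h z ≤ ∫⁻ z in ball y r, ({x | l < h x}.indicator h z + l) := by
        refine lintegral_mono fun z => ?_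
        by_cases hz : l < h z
        · simp [indicator, hz]
        · simpa [indicator, hz] using not_lt.1 hz
    _ = (∫⁻ z in ball y r, {x | l < h x}.indicator h z) + l * volume (ball y r) := by
        rw [lintegral_add_right _ measurable_const, setLIntegral_const]
    _ ≤ _ := by
        rw [add_mul]
        gcongr
        rw [mul_comm]
        exact le_maxFn _ hx

/-- The maximal function is bounded on `L^q` for `q > 1`. -/
theorem lintegral_maxFn_rpow_le {n : ℕ} {q : ℝ} (hq : 1 < q) {h : En n → ℝ≥0∞}
    (hh : Measurable h) :
    ∫⁻ x, maxFn h x ^ q ≤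
      ENNReal.ofReal (2 ^ q * q * 5 ^ n * (q - 1)⁻¹) * ∫⁻ x, h x ^ q := by
  have hq0 : 0 < q := by linarith
  have hM : Measurable fun x => 2⁻¹ * maxFn h x := (measurable_maxFn h).const_mul _
  have hlevel : ∀ t : ℝ, 0 < t →
      ENNReal.ofReal (t ^ (q - 1)) * volume {x | ENNReal.ofReal t < 2⁻¹ * maxFn h x} ≤
      ENNReal.ofReal (5 ^ n) * (ENNReal.ofReal (t ^ (q - 1 - 1)) *
        ∫⁻ x in {x | ENNReal.ofReal t < h x}, h x) := by
    intro t ht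
    have hS : MeasurableSet {x | ENNReal.ofReal t < h x} := measurableSet_lt measurable_const hh
    have hsub : {x | ENNReal.ofReal t < 2⁻¹ * maxFn h x} ⊆
        {x | ENNReal.ofReal t < maxFn ({x | ENNReal.ofReal t < h x}.indicator h) x} := by
      intro x hx
      simp only [mem_ofPred_eq] at hx ⊢
      by_contra! hcon
      refine hx.not_ge ?_
      calc 2⁻¹ * maxFn h x ≤ 2⁻¹ * (ENNReal.ofReal t + ENNReal.ofReal t) := by
            gcongr
            exact (maxFn_le_add hh _ x).trans (by gcongr)
        _ = ENNReal.ofReal t := by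
            rw [← two_mul, ← mul_assoc, ENNReal.inv_mul_cancel (by simp) (by simp), one_mul]
    have hw := mul_volume_lt_maxFn_le ({x | ENNReal.ofReal t < h x}.indicator h) (ENNReal.ofReal t)
    rw [lintegral_indicator hS] at hw
    have hpow : t ^ (q - 1) = t ^ (q - 1 - 1) * t := by
      rw [← Real.rpow_add_one ht.ne']; ring_nf
    calc _ ≤ ENNReal.ofReal (t ^ (q - 1 - 1)) * (ENNReal.ofReal t *
          volume {x | ENNReal.ofReal t < maxFn ({x | ENNReal.ofReal t < h x}.indicator h) x}) := by
          rw [hpow, ENNReal.ofReal_mul (by positivity), mul_assoc]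
          gcongr
      _ ≤ ENNReal.ofReal (t ^ (q - 1 - 1)) * (ENNReal.ofReal (5 ^ n) *
          ∫⁻ x in {x | ENNReal.ofReal t < h x}, h x) := by gcongr
      _ = _ := by ring
  have hhalf : ENNReal.ofReal q⁻¹ * ∫⁻ x, (2⁻¹ * maxFn h x) ^ q ≤
      ENNReal.ofReal (5 ^ n) * (ENNReal.ofReal (q - 1)⁻¹ * ∫⁻ x, h x ^ q) := by
    have hpow : ∀ x, h x ^ q = h x ^ (q - 1) * h x := fun x => by
      conv_rhs => rw [← ENNReal.rpow_one (h x), ← ENNReal.rpow_mul, one_mul,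
        ← ENNReal.rpow_add_of_nonneg _ _ (by linarith) zero_le_one, sub_add_cancel]
    simp only [hpow]
    rw [← lintegral_rpow_eq_layercake volume hq0 hM,
      ← lintegral_rpow_mul_eq_layercake volume (by linarith : 0 < q - 1) hh hh,
      ← lintegral_const_mul' _ _ ENNReal.ofReal_ne_top]
    exact setLIntegral_mono' measurableSet_Ioi hlevel
  have hfull : ∫⁻ x, maxFn h x ^ q =
      ENNReal.ofReal (2 ^ q * q) * (ENNReal.ofReal q⁻¹ * ∫⁻ x, (2⁻¹ * maxFn h x) ^ q) := by
    rw [← mul_assoc, ← ENNReal.ofReal_mul (by positivity), mul_assoc, mul_inv_cancel₀ hq0.ne',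
      mul_one, ← ENNReal.ofReal_rpow_of_pos two_pos, ← lintegral_const_mul _ (by fun_prop)]
    refine lintegral_congr fun x => ?_
    rw [← ENNReal.mul_rpow_of_nonneg _ _ hq0.le, ← mul_assoc, ENNReal.ofReal_ofNat,
      ENNReal.mul_inv_cancel (by simp) (by simp), one_mul]
  rw [hfull]
  refine (mul_le_mul_right hhalf _).trans_eq ?_
  rw [← mul_assoc, ← mul_assoc, ← ENNReal.ofReal_mul (by positivity),
    ← ENNReal.ofReal_mul (by positivity)]

/-- The square of the conical square function, for a general density `w`. -/
def coneIntegral {n : ℕ} (α : ℝ) (w : ℝ → En n → ℝ≥0∞) (x : En n) : ℝ≥0∞ :=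
  ∫⁻ t in Ioi (0 : ℝ), ∫⁻ y, (ball x (α * t)).indicator (w t) y

/-- The points of `ℝ × ℝⁿ × ℝⁿ` lying in the cones of aperture `α`. -/
def coneSet (n : ℕ) (α : ℝ) : Set ((ℝ × En n) × En n) := {z | z.2 ∈ ball z.1.2 (α * z.1.1)}

theorem measurableSet_coneSet (n : ℕ) (α : ℝ) : MeasurableSet (coneSet n α) :=
  measurableSet_lt (f := fun z : (ℝ × En n) × En n => dist z.2 z.1.2) (by fun_prop) (by fun_prop)

theorem coneIntegral_eq {n : ℕ} (α : ℝ) {w : ℝ → En n → ℝ≥0∞}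
    (hw : Measurable (Function.uncurry w)) (x : En n) :
    coneIntegral α w x = ∫⁻ q in {q | (q, x) ∈ coneSet n α}, Function.uncurry w q
      ∂(volume.restrict (Ioi (0 : ℝ))).prod volume := by
  have hS : MeasurableSet {q | (q, x) ∈ coneSet n α} :=
    measurable_prodMk_right (measurableSet_coneSet n α)
  rw [← lintegral_indicator hS, lintegral_prod _ (hw.indicator hS).aemeasurable]
  refine lintegral_congr fun t => lintegral_congr fun y => ?_
  have hiff : y ∈ ball x (α * t) ↔ ((t, y), x) ∈ coneSet n α := mem_ball_comm
  by_cases h : y ∈ ball x (α * t)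
  · rw [indicator_of_mem h, indicator_of_mem (show (t, y) ∈ {q | (q, x) ∈ coneSet n α} from hiff.1 h)]
    rfl
  · rw [indicator_of_notMem h,
      indicator_of_notMem (show (t, y) ∉ {q | (q, x) ∈ coneSet n α} from mt hiff.2 h)]

theorem lintegral_coneIntegral_mul {n : ℕ} (α : ℝ) {w : ℝ → En n → ℝ≥0∞}
    (hw : Measurable (Function.uncurry w)) {h : En n → ℝ≥0∞} (hh : Measurable h) :
    ∫⁻ x, coneIntegral α w x * h x =
      ∫⁻ q : ℝ × En n, Function.uncurry w q * (∫⁻ x in ball q.2 (α * q.1), h x)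
        ∂(volume.restrict (Ioi (0 : ℝ))).prod volume := by
  refine Eq.trans ?_ (lintegral_mul_setLIntegral_swap _ volume hw hh
    (measurableSet_coneSet n α)).symm
  exact lintegral_congr fun x => by rw [coneIntegral_eq α hw, mul_comm]

theorem measurable_coneIntegral {n : ℕ} (α : ℝ) {w : ℝ → En n → ℝ≥0∞}
    (hw : Measurable (Function.uncurry w)) : Measurable (coneIntegral α w) := by
  have hS := measurableSet_coneSet n α
  have hm : Measurable fun x : En n => ∫⁻ q, (coneSet n α).indicator
      (fun z => Function.uncurry w z.1) (q, x) ∂(volume.restrict (Ioi (0 : ℝ))).prod volume :=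
    Measurable.lintegral_prod_left' ((hw.comp measurable_fst).indicator hS)
  convert hm using 2 with x
  rw [coneIntegral_eq α hw]
  exact (lintegral_indicator (measurable_prodMk_right hS) _).symm

theorem ae_fst_pos (n : ℕ) :
    ∀ᵐ q : ℝ × En n ∂(volume.restrict (Ioi (0 : ℝ))).prod volume, 0 < q.1 :=
  Measure.quasiMeasurePreserving_fst.ae (ae_restrict_mem measurableSet_Ioi)

theorem setLIntegral_ball_mul_le_maxFn {n : ℕ} {α r : ℝ} (hα : 1 ≤ α) (hr : 0 < r)
    (h : En n → ℝ≥0∞) (y : En n) :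
    ∫⁻ x in ball y (α * r), h x ≤ ENNReal.ofReal (α ^ n) * ∫⁻ x in ball y r, maxFn h x := by
  have hpos := (measure_ball_pos volume y hr).ne'
  have htop := (measure_ball_lt_top (μ := volume) (x := y) (r := r)).ne
  refine (ENNReal.mul_le_mul_iff_left hpos htop).1 ?_
  calc (∫⁻ x in ball y (α * r), h x) * volume (ball y r)
      = ∫⁻ _ in ball y r, ∫⁻ x in ball y (α * r), h x := (setLIntegral_const _ _).symm
    _ ≤ ∫⁻ x in ball y r, volume (ball y (α * r)) * maxFn h x :=
        setLIntegral_mono' measurableSet_ball fun x hx =>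
          le_maxFn h (ball_subset_ball (by nlinarith) hx)
    _ = _ := by
        rw [lintegral_const_mul _ (measurable_maxFn h), volume_ball_mul (by linarith)]
        ring

theorem lintegral_coneIntegral_mul_le_maxFn {n : ℕ} {α : ℝ} (hα : 1 ≤ α) {w : ℝ → En n → ℝ≥0∞}
    (hw : Measurable (Function.uncurry w)) {h : En n → ℝ≥0∞} (hh : Measurable h) :
    ∫⁻ x, coneIntegral α w x * h x ≤
      ENNReal.ofReal (α ^ n) * ∫⁻ x, coneIntegral 1 w x * maxFn h x := by
  rw [lintegral_coneIntegral_mul α hw hh, lintegral_coneIntegral_mul 1 hw (measurable_maxFn h),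
    ← lintegral_const_mul' _ _ ENNReal.ofReal_ne_top]
  refine lintegral_mono_ae ((ae_fst_pos n).mono fun q hq => ?_)
  rw [mul_left_comm, one_mul]
  exact mul_le_mul_right (setLIntegral_ball_mul_le_maxFn hα hq h q.2) _

theorem maxFn_one_le {n : ℕ} (x : En n) : maxFn (fun _ => 1) x ≤ 1 := by
  refine iSup_le fun y => iSup_le fun r => iSup_le fun _ => ?_
  rw [setLIntegral_one]
  exact ENNReal.inv_mul_le_one _

theorem lintegral_coneIntegral_le {n : ℕ} {α : ℝ} (hα : 1 ≤ α) {w : ℝ → En n → ℝ≥0∞}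
    (hw : Measurable (Function.uncurry w)) :
    ∫⁻ x, coneIntegral α w x ≤ ENNReal.ofReal (α ^ n) * ∫⁻ x, coneIntegral 1 w x := by
  have h := lintegral_coneIntegral_mul_le_maxFn hα hw (h := fun _ => 1) measurable_const
  simp only [mul_one] at h
  refine h.trans (mul_le_mul_right (lintegral_mono fun x => ?_) _)
  exact mul_le_of_le_one_right' (maxFn_one_le x)

theorem ENNReal.le_rpow_of_le_mul_rpow {r q : ℝ} (hrq : r.HolderConjugate q) {X A : ℝ≥0∞}
    (hX : X ≠ ⊤) (h : X ≤ A * X ^ (1 / q)) : X ≤ A ^ r := by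
  rcases eq_or_ne X 0 with rfl | hX0
  · exact zero_le
  have hsplit : X = X ^ (1 / r) * X ^ (1 / q) := by
    rw [← ENNReal.rpow_add _ _ hX0 hX, one_div, one_div, hrq.inv_add_inv_eq_one, ENNReal.rpow_one]
  have hne0 : X ^ (1 / q) ≠ 0 := by simp [ENNReal.rpow_eq_zero_iff, hX0, hX]
  have hnetop : X ^ (1 / q) ≠ ⊤ := ENNReal.rpow_ne_top_of_nonneg (by have := hrq.symm.pos; positivity) hX
  have hle : X ^ (1 / r) ≤ A := by
    refine (ENNReal.mul_le_mul_iff_left hne0 hnetop).1 ?_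
    rwa [← hsplit]
  calc X = (X ^ (1 / r)) ^ r := by
        rw [← ENNReal.rpow_mul, one_div_mul_cancel hrq.pos.ne', ENNReal.rpow_one]
    _ ≤ A ^ r := ENNReal.rpow_le_rpow hle hrq.pos.le

/-- Functions bounded by `N` and supported in a ball suffice to test `L^r` bounds. -/
theorem lintegral_rpow_le_of_truncation {n : ℕ} {r : ℝ} (hr : 0 < r) {U : En n → ℝ≥0∞}
    (hU : Measurable U) {B : ℝ≥0∞}
    (h : ∀ k : En n → ℝ≥0∞, Measurable k → k ≤ U → ∫⁻ x, k x ^ r ≠ ⊤ → ∫⁻ x, k x ^ r ≤ B) :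
    ∫⁻ x, U x ^ r ≤ B := by
  let k : ℕ → En n → ℝ≥0∞ := fun N => (ball 0 (N : ℝ)).indicator fun x => min (U x) N
  have hk : ∀ N, Measurable (k N) := fun N =>
    (hU.min measurable_const).indicator measurableSet_ball
  have hkU : ∀ N, k N ≤ U := fun N =>
    fun x => (indicator_le_self _ _ x).trans (min_le_left _ _)
  have hmono : Monotone k := by
    intro N M hNM x
    have hcast : (N : ℝ) ≤ M := by exact_mod_cast hNM
    refine (indicator_le_indicator_of_subset (ball_subset_ball hcast) (fun _ => zero_le) x).trans ?_
    refine indicator_le_indicator ?_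
    exact min_le_min_left _ (by exact_mod_cast hNM)
  have hfin : ∀ N, ∫⁻ x, k N x ^ r ≠ ⊤ := by
    intro N
    refine ne_top_of_le_ne_top (b := (N : ℝ≥0∞) ^ r * volume (ball (0 : En n) N)) ?_ ?_
    · exact ENNReal.mul_ne_top (ENNReal.rpow_ne_top_of_nonneg hr.le (by simp))
        measure_ball_lt_top.ne
    · rw [← lintegral_indicator_const measurableSet_ball]
      refine lintegral_mono fun x => ?_
      by_cases hx : x ∈ ball (0 : En n) N
      · simp only [k, indicator_of_mem hx]
        exact ENNReal.rpow_le_rpow (min_le_right _ _) hr.le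
      · simp [k, indicator_of_notMem hx, hr]
  have hsup : ∀ x, U x ^ r ≤ ⨆ N, k N x ^ r := by
    intro x
    have hlim : Tendsto (fun N : ℕ => min (U x) (N : ℝ≥0∞) ^ r) atTop (nhds (U x ^ r)) := by
      refine (ENNReal.continuous_rpow_const.tendsto _).comp ?_
      simpa using (tendsto_const_nhds (x := U x)).min ENNReal.tendsto_nat_nhds_top
    obtain ⟨N₀, hN₀⟩ := exists_nat_gt (dist x 0)
    refine le_of_tendsto hlim ((eventually_ge_atTop N₀).mono fun N hN => ?_)
    have hx : x ∈ ball (0 : En n) N := hN₀.trans_le (by exact_mod_cast hN)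
    refine le_iSup_of_le N ?_
    simp only [k, indicator_of_mem hx, le_refl]
  calc ∫⁻ x, U x ^ r ≤ ∫⁻ x, ⨆ N, k N x ^ r := lintegral_mono hsup
    _ = ⨆ N, ∫⁻ x, k N x ^ r :=
        lintegral_iSup (fun N => (hk N).pow_const r)
          fun N M hNM x => ENNReal.rpow_le_rpow (hmono hNM x) hr.le
    _ ≤ B := iSup_le fun N => h _ (hk N) (hkU N) (hfin N)

/-- Change of aperture for `L^r` norms of cone integrals, `r > 1`. -/
theorem exists_lintegral_coneIntegral_rpow_le (n : ℕ) {r : ℝ} (hr : 1 < r) :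
    ∃ C : ℝ, 0 < C ∧ ∀ α : ℝ, 1 ≤ α → ∀ w : ℝ → En n → ℝ≥0∞, Measurable (Function.uncurry w) →
      ∫⁻ x, coneIntegral α w x ^ r ≤
        ENNReal.ofReal (C * (α ^ n) ^ r) * ∫⁻ x, coneIntegral 1 w x ^ r := by
  have hrq := Real.HolderConjugate.conjExponent hr
  set q := r.conjExponent
  have hq : 1 < q := hrq.symm.lt
  have hq0 : 0 < q := by linarith
  have hr0 : 0 < r := by linarith
  set D : ℝ := 2 ^ q * q * 5 ^ n * (q - 1)⁻¹
  have hq1 : 0 < q - 1 := by linarith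
  have hD : 0 < D := by positivity
  refine ⟨(D ^ (1 / q)) ^ r, by positivity, fun α hα w hw => ?_⟩
  have hα0 : 0 < α := by linarith
  have hu := measurable_coneIntegral 1 hw
  refine lintegral_rpow_le_of_truncation hr0 (measurable_coneIntegral α hw)
    fun k hk hkU hfin => ?_
  have hkr : Measurable fun x => k x ^ (r - 1) := hk.pow_const _
  have hkq : ∀ x, (k x ^ (r - 1)) ^ q = k x ^ r := fun x => by
    rw [← ENNReal.rpow_mul, hrq.sub_one_mul_conj]
  have hbound : ∫⁻ x, k x ^ r ≤ (ENNReal.ofReal (α ^ n) * (∫⁻ x, coneIntegral 1 w x ^ r) ^ (1 / r) *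
      ENNReal.ofReal (D ^ (1 / q))) * (∫⁻ x, k x ^ r) ^ (1 / q) := by
    calc ∫⁻ x, k x ^ r ≤ ∫⁻ x, coneIntegral α w x * k x ^ (r - 1) := by
          refine lintegral_mono fun x => ?_
          calc k x ^ r = k x * k x ^ (r - 1) := by
                conv_rhs => rw [← ENNReal.rpow_one (k x), ← ENNReal.rpow_mul, one_mul,
                  ← ENNReal.rpow_add_of_nonneg _ _ zero_le_one (by linarith), add_sub_cancel]
            _ ≤ _ := mul_le_mul_left (hkU x) _
      _ ≤ ENNReal.ofReal (α ^ n) * ∫⁻ x, coneIntegral 1 w x * maxFn (fun x => k x ^ (r - 1)) x :=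
          lintegral_coneIntegral_mul_le_maxFn hα hw hkr
      _ ≤ ENNReal.ofReal (α ^ n) * ((∫⁻ x, coneIntegral 1 w x ^ r) ^ (1 / r) *
            (∫⁻ x, maxFn (fun x => k x ^ (r - 1)) x ^ q) ^ (1 / q)) :=
          mul_le_mul_right (ENNReal.lintegral_mul_le_Lp_mul_Lq volume hrq hu.aemeasurable
            (measurable_maxFn _).aemeasurable) _
      _ ≤ ENNReal.ofReal (α ^ n) * ((∫⁻ x, coneIntegral 1 w x ^ r) ^ (1 / r) *
            (ENNReal.ofReal D * ∫⁻ x, k x ^ r) ^ (1 / q)) := by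
          have hmax := lintegral_maxFn_rpow_le hq hkr
          simp only [hkq] at hmax
          gcongr
      _ = _ := by
          rw [ENNReal.mul_rpow_of_nonneg _ _ (by positivity),
            ENNReal.ofReal_rpow_of_pos hD]
          ring
  refine (ENNReal.le_rpow_of_le_mul_rpow hrq hfin hbound).trans_eq ?_
  rw [ENNReal.mul_rpow_of_nonneg _ _ hr0.le, ENNReal.mul_rpow_of_nonneg _ _ hr0.le,
    ← ENNReal.rpow_mul, one_div_mul_cancel hr0.ne', ENNReal.rpow_one,
    ENNReal.ofReal_rpow_of_pos (by positivity), ENNReal.ofReal_rpow_of_pos (by positivity),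
    ENNReal.ofReal_mul (by positivity)]
  ring

/-- Change of aperture on the set where `O` has small density at every scale. -/
theorem setLIntegral_coneIntegral_le {n : ℕ} {α : ℝ} (hα : 1 ≤ α) {w : ℝ → En n → ℝ≥0∞}
    (hw : Measurable (Function.uncurry w)) {O : Set (En n)} (hO : MeasurableSet O) :
    ∫⁻ x in {x | ENNReal.ofReal (2 * α ^ n)⁻¹ < maxFn (O.indicator fun _ => 1) x}ᶜ,
      coneIntegral α w x ≤ ENNReal.ofReal (2 * α ^ n) * ∫⁻ x in Oᶜ, coneIntegral 1 w x := by
  set G := {x | ENNReal.ofReal (2 * α ^ n)⁻¹ < maxFn (O.indicator fun _ => 1) x}ᶜ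
  have hα0 : 0 < α := by linarith
  have hG : MeasurableSet G := (isOpen_lt_maxFn _ _).measurableSet.compl
  have hset : ∀ (β : ℝ) (A : Set (En n)), MeasurableSet A → ∫⁻ x in A, coneIntegral β w x =
      ∫⁻ q, Function.uncurry w q * volume (A ∩ ball q.2 (β * q.1))
        ∂(volume.restrict (Ioi (0 : ℝ))).prod volume := by
    intro β A hA
    have h := lintegral_coneIntegral_mul β hw (h := A.indicator fun _ => 1)
      (measurable_const.indicator hA)
    simp only [lintegral_indicator_const hA, one_mul, Measure.restrict_apply hA] at h
    rw [← h, ← lintegral_indicator hA]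
    refine lintegral_congr fun x => ?_
    by_cases hx : x ∈ A <;> simp [hx]
  rw [hset α G hG, hset 1 _ hO.compl, ← lintegral_const_mul' _ _ ENNReal.ofReal_ne_top]
  refine lintegral_mono_ae ((ae_fst_pos n).mono fun q hq => ?_)
  rw [mul_left_comm, one_mul]
  refine mul_le_mul_right ?_ _
  rcases (G ∩ ball q.2 (α * q.1)).eq_empty_or_nonempty with hemp | ⟨x, hxG, hx⟩
  · simp [hemp]
  set V := volume (ball q.2 q.1)
  have hV : V ≠ ⊤ := measure_ball_lt_top.ne
  have hvol : volume (ball q.2 (α * q.1)) = ENNReal.ofReal (α ^ n) * V := volume_ball_mul hα0 _ _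
  have hsmall : volume (O ∩ ball q.2 q.1) ≤ 2⁻¹ * V := by
    have h1 := le_maxFn (O.indicator fun _ => 1) hx
    rw [lintegral_indicator_const hO, one_mul, Measure.restrict_apply hO, hvol] at h1
    have h2 : maxFn (O.indicator fun _ => 1) x ≤ ENNReal.ofReal (2 * α ^ n)⁻¹ := not_lt.1 hxG
    calc volume (O ∩ ball q.2 q.1) ≤ volume (O ∩ ball q.2 (α * q.1)) := by
          gcongr
          nlinarith
      _ ≤ ENNReal.ofReal (α ^ n) * V * ENNReal.ofReal (2 * α ^ n)⁻¹ :=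
          h1.trans (mul_le_mul_right h2 _)
      _ = ENNReal.ofReal (α ^ n * (2 * α ^ n)⁻¹) * V := by
          rw [ENNReal.ofReal_mul (by positivity)]; ring
      _ = 2⁻¹ * V := by
          rw [show α ^ n * (2 * α ^ n)⁻¹ = 2⁻¹ by field_simp,
            ENNReal.ofReal_inv_of_pos two_pos, ENNReal.ofReal_ofNat]
  have hhalf : V ≤ 2 * volume (Oᶜ ∩ ball q.2 q.1) := by
    have hsum : V = volume (O ∩ ball q.2 q.1) + volume (Oᶜ ∩ ball q.2 q.1) := by
      rw [inter_comm O, inter_comm Oᶜ, ← Set.sdiff_eq]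
      exact (measure_inter_add_sdiff _ hO).symm
    have hVV : 2⁻¹ * V + 2⁻¹ * V ≤ 2⁻¹ * V + volume (Oᶜ ∩ ball q.2 q.1) := by
      rw [← add_mul, ENNReal.inv_two_add_inv_two, one_mul]
      exact hsum.le.trans (by gcongr)
    have hle := (ENNReal.add_le_add_iff_left (ENNReal.mul_ne_top (by simp) hV)).1 hVV
    calc V = 2 * (2⁻¹ * V) := by
          rw [← mul_assoc, ENNReal.mul_inv_cancel (by simp) (by simp), one_mul]
      _ ≤ _ := by gcongr
  calc volume (G ∩ ball q.2 (α * q.1)) ≤ ENNReal.ofReal (α ^ n) * V :=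
        (measure_mono inter_subset_right).trans_eq hvol
    _ ≤ ENNReal.ofReal (α ^ n) * (2 * volume (Oᶜ ∩ ball q.2 q.1)) := by gcongr
    _ = _ := by
        rw [ENNReal.ofReal_mul (by norm_num), ENNReal.ofReal_ofNat]; ring

/-- Change of aperture in `L^p` for `p < 2`. -/
theorem lintegral_coneIntegral_sqrt_rpow_le {n : ℕ} {p : ℝ} (hp : 0 < p) (hp2 : p < 2) {α : ℝ}
    (hα : 1 ≤ α) {w : ℝ → En n → ℝ≥0∞} (hw : Measurable (Function.uncurry w)) :
    ∫⁻ x, (coneIntegral α w x ^ (1 / 2 : ℝ)) ^ p ≤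
      ENNReal.ofReal ((2 * 5 ^ n + 2 * p * (2 - p)⁻¹) * α ^ n) *
        ∫⁻ x, (coneIntegral 1 w x ^ (1 / 2 : ℝ)) ^ p := by
  have hα0 : 0 < α := by linarith
  set F := fun x => coneIntegral α w x ^ (1 / 2 : ℝ) with hFdef
  set f := fun x => coneIntegral 1 w x ^ (1 / 2 : ℝ) with hfdef
  have hF : Measurable F := (measurable_coneIntegral α hw).pow_const _
  have hf : Measurable f := (measurable_coneIntegral 1 hw).pow_const _
  have hF2 : ∀ x, F x ^ (2 : ℝ) = coneIntegral α w x := fun x => by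
    rw [hFdef, ← ENNReal.rpow_mul]; norm_num
  have hf2 : ∀ x, f x ^ (2 : ℝ) = coneIntegral 1 w x := fun x => by
    rw [hfdef, ← ENNReal.rpow_mul]; norm_num
  have hlevel : ∀ t : ℝ, 0 < t →
      ENNReal.ofReal (t ^ (p - 1)) * volume {x | ENNReal.ofReal t < F x} ≤
      ENNReal.ofReal (2 * 5 ^ n * α ^ n) *
        (ENNReal.ofReal (t ^ (p - 1)) * volume {x | ENNReal.ofReal t < f x}) +
      ENNReal.ofReal (2 * α ^ n) * (ENNReal.ofReal (t ^ (p - 3)) *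
        ∫⁻ x in {x | f x ≤ ENNReal.ofReal t}, f x ^ (2 : ℝ)) := by
    intro t ht
    set O := {x | ENNReal.ofReal t < f x}
    have hO : MeasurableSet O := measurableSet_lt measurable_const hf
    have hOc : Oᶜ = {x | f x ≤ ENNReal.ofReal t} := by ext; simp [O]
    set P := {x | ENNReal.ofReal (2 * α ^ n)⁻¹ < maxFn (O.indicator fun _ => 1) x}
    have hP : volume P ≤ ENNReal.ofReal (2 * 5 ^ n * α ^ n) * volume O := by
      have h := mul_volume_lt_maxFn_le (O.indicator fun _ => 1) (ENNReal.ofReal (2 * α ^ n)⁻¹)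
      rw [lintegral_indicator_const hO, one_mul] at h
      calc volume P = ENNReal.ofReal (2 * α ^ n) *
            (ENNReal.ofReal (2 * α ^ n)⁻¹ * volume P) := by
            rw [← mul_assoc, ← ENNReal.ofReal_mul (by positivity),
              mul_inv_cancel₀ (by positivity), ENNReal.ofReal_one, one_mul]
        _ ≤ ENNReal.ofReal (2 * α ^ n) * (ENNReal.ofReal (5 ^ n) * volume O) := by gcongr
        _ = _ := by
            rw [← mul_assoc, ← ENNReal.ofReal_mul (by positivity)]; ring_nf
    have hsq : ENNReal.ofReal (t ^ (2 : ℝ)) * volume (Pᶜ ∩ {x | ENNReal.ofReal t < F x}) ≤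
        ENNReal.ofReal (2 * α ^ n) * ∫⁻ x in Oᶜ, f x ^ (2 : ℝ) := by
      have hPm : MeasurableSet Pᶜ := (isOpen_lt_maxFn _ _).measurableSet.compl
      have hFm : MeasurableSet {x | ENNReal.ofReal t < F x} := measurableSet_lt measurable_const hF
      calc _ = ∫⁻ _ in Pᶜ ∩ {x | ENNReal.ofReal t < F x}, ENNReal.ofReal (t ^ (2 : ℝ)) :=
            (setLIntegral_const _ _).symm
        _ ≤ ∫⁻ x in Pᶜ ∩ {x | ENNReal.ofReal t < F x}, F x ^ (2 : ℝ) := by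
            refine setLIntegral_mono' (hPm.inter hFm) fun x hx => ?_
            rw [← ENNReal.ofReal_rpow_of_pos ht]
            exact ENNReal.rpow_le_rpow (le_of_lt hx.2) (by norm_num)
        _ ≤ ∫⁻ x in Pᶜ, F x ^ (2 : ℝ) := lintegral_mono_set inter_subset_left
        _ ≤ _ := by
            simp only [hF2, hf2]
            exact setLIntegral_coneIntegral_le hα hw hO
    have hcover : volume {x | ENNReal.ofReal t < F x} ≤
        volume P + volume (Pᶜ ∩ {x | ENNReal.ofReal t < F x}) := by
      refine (measure_mono fun x hx => ?_).trans (measure_union_le _ _)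
      by_cases hxP : x ∈ P
      · exact Or.inl hxP
      · exact Or.inr ⟨hxP, hx⟩
    have hpow : t ^ (p - 1) = t ^ (p - 3) * t ^ (2 : ℝ) := by
      rw [← Real.rpow_add ht]; ring_nf
    calc _ ≤ ENNReal.ofReal (t ^ (p - 1)) *
          (volume P + volume (Pᶜ ∩ {x | ENNReal.ofReal t < F x})) := by gcongr
      _ = ENNReal.ofReal (t ^ (p - 1)) * volume P + ENNReal.ofReal (t ^ (p - 3)) *
          (ENNReal.ofReal (t ^ (2 : ℝ)) * volume (Pᶜ ∩ {x | ENNReal.ofReal t < F x})) := by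
          rw [mul_add, ← mul_assoc (ENNReal.ofReal (t ^ (p - 3))),
            ← ENNReal.ofReal_mul (by positivity), ← hpow]
      _ ≤ ENNReal.ofReal (t ^ (p - 1)) * (ENNReal.ofReal (2 * 5 ^ n * α ^ n) * volume O) +
          ENNReal.ofReal (t ^ (p - 3)) *
            (ENNReal.ofReal (2 * α ^ n) * ∫⁻ x in Oᶜ, f x ^ (2 : ℝ)) := by gcongr
      _ = _ := by rw [hOc]; ring
  have hlarge : ∫⁻ t in Ioi (0 : ℝ), ENNReal.ofReal (t ^ (p - 3)) *
      ∫⁻ x in {x | f x ≤ ENNReal.ofReal t}, f x ^ (2 : ℝ) ≤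
      ENNReal.ofReal (2 - p)⁻¹ * ∫⁻ x, f x ^ p := by
    have h := lintegral_mul_setLIntegral_swap (volume.restrict (Ioi (0 : ℝ))) volume
      (measurable_ofReal_rpow (p - 3)) (hf.pow_const (2 : ℝ))
      (S := {q : ℝ × En n | f q.2 ≤ ENNReal.ofReal q.1})
      (measurableSet_le (by fun_prop) (by fun_prop))
    simp only [mem_ofPred_eq] at h
    rw [h, ← lintegral_const_mul _ (hf.pow_const p)]
    exact lintegral_mono fun x =>
      (mul_lintegral_rpow_sub_three_of_le hp2 (f x)).trans_eq (mul_comm _ _)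
  have hmeas : Measurable fun t : ℝ =>
      ENNReal.ofReal (t ^ (p - 1)) * volume {x | ENNReal.ofReal t < f x} :=
    (measurable_ofReal_rpow _).mul (measurable_measure_prodMk_left (measurableSet_ofReal_lt hf))
  have hint : ENNReal.ofReal p⁻¹ * ∫⁻ x, F x ^ p ≤
      ENNReal.ofReal (2 * 5 ^ n * α ^ n) * (ENNReal.ofReal p⁻¹ * ∫⁻ x, f x ^ p) +
      ENNReal.ofReal (2 * α ^ n) * (ENNReal.ofReal (2 - p)⁻¹ * ∫⁻ x, f x ^ p) := by
    rw [← lintegral_rpow_eq_layercake volume hp hF, ← lintegral_rpow_eq_layercake volume hp hf]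
    refine (setLIntegral_mono' measurableSet_Ioi hlevel).trans ?_
    rw [lintegral_add_left (hmeas.const_mul _), lintegral_const_mul' _ _ ENNReal.ofReal_ne_top,
      lintegral_const_mul' _ _ ENNReal.ofReal_ne_top]
    gcongr
  have h2p : 0 < 2 - p := by linarith
  calc ∫⁻ x, F x ^ p = ENNReal.ofReal p * (ENNReal.ofReal p⁻¹ * ∫⁻ x, F x ^ p) := by
        rw [← mul_assoc, ← ENNReal.ofReal_mul hp.le, mul_inv_cancel₀ hp.ne', ENNReal.ofReal_one,
          one_mul]
    _ ≤ ENNReal.ofReal p * _ := mul_le_mul_right hint _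
    _ = (ENNReal.ofReal (p * (2 * 5 ^ n * α ^ n) * p⁻¹) +
          ENNReal.ofReal (p * (2 * α ^ n) * (2 - p)⁻¹)) * ∫⁻ x, f x ^ p := by
        rw [ENNReal.ofReal_mul (by positivity : 0 ≤ p * (2 * 5 ^ n * α ^ n)),
          ENNReal.ofReal_mul (by positivity : 0 ≤ p * (2 * α ^ n)),
          ENNReal.ofReal_mul (q := 2 * 5 ^ n * α ^ n) hp.le,
          ENNReal.ofReal_mul (q := 2 * α ^ n) hp.le]
        ring
    _ = _ := by
        rw [← ENNReal.ofReal_add (by positivity) (by positivity)]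
        congr 2
        field_simp

theorem exists_lintegral_coneIntegral_sqrt_rpow_le (n : ℕ) {p : ℝ} (hp : 0 < p) :
    ∃ C : ℝ, 0 < C ∧ ∀ α : ℝ, 1 ≤ α → ∀ w : ℝ → En n → ℝ≥0∞, Measurable (Function.uncurry w) →
      ∫⁻ x, (coneIntegral α w x ^ (1 / 2 : ℝ)) ^ p ≤
        ENNReal.ofReal (C * (α ^ ((n : ℝ) / min p 2)) ^ p) *
          ∫⁻ x, (coneIntegral 1 w x ^ (1 / 2 : ℝ)) ^ p := by
  rcases lt_trichotomy p 2 with hp2 | rfl | hp2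
  · have h2p : 0 < 2 - p := by linarith
    refine ⟨2 * 5 ^ n + 2 * p * (2 - p)⁻¹, by positivity, fun α hα w hw => ?_⟩
    have hα0 : 0 < α := by linarith
    rw [min_eq_left hp2.le, ← Real.rpow_mul hα0.le, div_mul_cancel₀ _ hp.ne', Real.rpow_natCast]
    exact lintegral_coneIntegral_sqrt_rpow_le hp hp2 hα hw
  · refine ⟨1, one_pos, fun α hα w hw => ?_⟩
    have hα0 : 0 < α := by linarith
    rw [min_self, ← Real.rpow_mul hα0.le, div_mul_cancel₀ _ two_ne_zero, Real.rpow_natCast, one_mul]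
    simpa only [← ENNReal.rpow_mul, one_div_mul_cancel (two_ne_zero (α := ℝ)), ENNReal.rpow_one]
      using lintegral_coneIntegral_le hα hw
  · obtain ⟨C, hC, h⟩ := exists_lintegral_coneIntegral_rpow_le n (r := p / 2) (by linarith)
    refine ⟨C, hC, fun α hα w hw => ?_⟩
    have hα0 : 0 < α := by linarith
    have hexp : (α ^ ((n : ℝ) / 2)) ^ p = (α ^ n) ^ (p / 2) := by
      rw [← Real.rpow_natCast, ← Real.rpow_mul hα0.le, ← Real.rpow_mul hα0.le]
      ring_nf
    rw [min_eq_right hp2.le, hexp]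
    simpa only [← ENNReal.rpow_mul, one_div_mul_eq_div] using h α hα w hw

/-- For `τ = min(p,2)` there is `C = C(n,p) > 0` such that for all `α ≥ 1`,
`‖g‖_{T^{p,2}_α} ≤ C α^{n/τ} ‖g‖_{T^{p,2}_1}`. -/
theorem statement3 (n : ℕ) (hn : 1 ≤ n) (p : ℝ) (hp : 0 < p) :
    ∃ C : ℝ, 0 < C ∧ ∀ α : ℝ, 1 ≤ α → ∀ g : ℝ → En n → ℝ, LocSqInt n g →
      tentNorm n p α g ≤
        ENNReal.ofReal (C * α ^ ((n : ℝ) / min p 2)) * tentNorm n p 1 g := by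
  obtain ⟨C, hC, h⟩ := exists_lintegral_coneIntegral_sqrt_rpow_le n hp
  refine ⟨C ^ (1 / p), by positivity, fun α hα g hg => ?_⟩
  have hα0 : 0 < α := by linarith
  have hgm := hg.1
  have hw : Measurable (Function.uncurry fun (t : ℝ) (y : En n) =>
      ENNReal.ofReal (|g t y| ^ 2 / t ^ (n + 1))) :=
    ((hgm.norm.pow_const 2).div (measurable_fst.pow_const (n + 1))).ennreal_ofReal
  have hpow := ENNReal.rpow_le_rpow (h α hα _ hw) (by positivity : 0 ≤ 1 / p)
  rw [ENNReal.mul_rpow_of_nonneg _ _ (by positivity), ENNReal.ofReal_rpow_of_pos (by positivity),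
    Real.mul_rpow hC.le (by positivity), ← Real.rpow_mul (by positivity) p,
    mul_one_div_cancel hp.ne', Real.rpow_one] at hpow
  exact hpow

end
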